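/- arXiv:2504.00997 — 2 statements merged into one kernel-verified Lean document; each statement's English description precedes it below -/
import Mathlib

section
/- Assume the mechanical setting, and let Φᵃ : ℝⁿ → ℝⁿ (a = 1, …, k) be smooth maps such that for every q each Φᵃ(q) annihilates the constraint distribution: Σᵢ Φᵃᵢ(q) vᵢ = 0 for all v ∈ D(q). Let X : ℝⁿ×ℝⁿ×ℝ → ℝⁿ×ℝⁿ×ℝ be a vector field and λ₁, …, λ_k : ℝⁿ×ℝⁿ×ℝ → ℝ functions such that at every point x = (q,p,z) of M×ℝ the covector equation ♭ₓ(X(x)) − dH(x) + (H(x) + ∂H/∂z(x)) ηₓ = Σₐ λₐ(x) Σᵢ Φᵃᵢ(q) dqⁱ holds. Then every differentiable integral curve t ↦ ξ(t) = (q(t), p(t), z(t)) of X that lies in M×ℝ satisfies, for all t and all indices i, a: dqⁱ/dt = ∂H/∂pᵢ, dpᵢ/dt = −∂H/∂qⁱ − pᵢ ∂H/∂z − Σₐ λₐ Φᵃᵢ, dz/dt = Σᵢ pᵢ ∂H/∂pᵢ − H (all partial derivatives of H evaluated along ξ(t)), and Σᵢ Φᵃᵢ(q(t)) dqⁱ/dt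 = 0. -/
open scoped BigOperators Matrix
noncomputable section

/-- Phase space `ℝⁿ × ℝⁿ × ℝ`, modeling `T*Q × ℝ` for `Q = ℝⁿ`. -/
abbrev PS (n : ℕ) := (Fin n → ℝ) × (Fin n → ℝ) × ℝ

/-- Partial derivative in the `qⁱ` direction. -/
def pdq {n : ℕ} (F : PS n → ℝ) (x : PS n) (i : Fin n) : ℝ :=
  fderiv ℝ F x (Pi.single i 1, 0, 0)

/-- Partial derivative in the `pᵢ` direction. -/
def pdp {n : ℕ} (F : PS n → ℝ) (x : PS n) (i : Fin n) : ℝ :=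
  fderiv ℝ F x (0, Pi.single i 1, 0)

/-- Partial derivative in the `z` direction. -/
def pdz {n : ℕ} (F : PS n → ℝ) (x : PS n) : ℝ :=
  fderiv ℝ F x (0, 0, 1)

/-- The flat map `♭ₓ(v) = ι_v dη + η(v) η` at `x = (q,p,z)`, for `η = dz − Σ pᵢ dqⁱ`;
covectors are identified with triples (dq-components, dp-components, dz-component). -/
def flatMap {n : ℕ} (x : PS n) (v : PS n) : PS n :=
  (fun i => -v.2.1 i - (v.2.2 - ∑ j, x.2.1 j * v.1 j) * x.2.1 i,
   v.1,
   v.2.2 - ∑ j, x.2.1 j * v.1 j)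

/-- The contact Hamiltonian vector field of `F`. -/
def XH {n : ℕ} (F : PS n → ℝ) (x : PS n) : PS n :=
  (fun i => pdp F x i,
   fun i => -pdq F x i - x.2.1 i * pdz F x,
   (∑ i, x.2.1 i * pdp F x i) - F x)

/-- The contact (Jacobi) bracket. -/
def jacB {n : ℕ} (f g : PS n → ℝ) (x : PS n) : ℝ :=
  (∑ i, (pdp f x i * pdq g x i - pdp g x i * pdq f x i))
  + (∑ i, x.2.1 i * (pdp f x i * pdz g x - pdp g x i * pdz f x))
  + g x * pdz f x - f x * pdz g x

/-- The differential of `F` at `x`, as a covector triple. -/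
def dCov {n : ℕ} (F : PS n → ℝ) (x : PS n) : PS n :=
  (fun i => pdq F x i, fun i => pdp F x i, pdz F x)

/-- The contact form `η = dz − Σ pᵢ dqⁱ` at `x`, as a covector triple. -/
def etaCov {n : ℕ} (x : PS n) : PS n :=
  (fun i => -x.2.1 i, 0, 1)

/-- The mechanical setting: a smooth Riemannian metric `G` on `ℝⁿ`, a smooth potential `V`,
and a smooth fiberwise projection `P` (idempotent, `G⁻¹`-symmetric) onto the constraint
subbundle along the annihilator of the constraint distribution. -/
structure MechSetting (n : ℕ) where
  hn : 1 ≤ n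
  G : (Fin n → ℝ) → Matrix (Fin n) (Fin n) ℝ
  V : (Fin n → ℝ) × ℝ → ℝ
  P : (Fin n → ℝ) → Matrix (Fin n) (Fin n) ℝ
  G_smooth : ∀ i j, ContDiff ℝ (⊤ : ℕ∞) (fun q => G q i j)
  G_symm : ∀ q, (G q).IsSymm
  G_posdef : ∀ q, (G q).PosDef
  V_smooth : ContDiff ℝ (⊤ : ℕ∞) V
  P_smooth : ∀ i j, ContDiff ℝ (⊤ : ℕ∞) (fun q => P q i j)
  P_proj : ∀ q, P q * P q = P q
  P_symm : ∀ q, (P q)ᵀ * (G q)⁻¹ = (G q)⁻¹ * P q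

namespace MechSetting

variable {n : ℕ} (S : MechSetting n)

/-- The mechanical Hamiltonian `H(q,p,z) = ½ pᵀ G(q)⁻¹ p + V(q,z)`. -/
def H (x : PS n) : ℝ :=
  (1 / 2) * (∑ i, ∑ j, x.2.1 i * (S.G x.1)⁻¹ i j * x.2.1 j) + S.V (x.1, x.2.2)

/-- The projection `Γ(q,p,z) = (q, P(q)p, z)` onto `M×ℝ`. -/
def Gam (x : PS n) : PS n :=
  (x.1, (S.P x.1).mulVec x.2.1, x.2.2)

/-- Membership in the constraint submanifold `M×ℝ = {(q,p,z) : P(q)p = p}`. -/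
def onM (x : PS n) : Prop :=
  (S.P x.1).mulVec x.2.1 = x.2.1

/-- The constraint distribution `D(q) = {G(q)⁻¹ m : P(q) m = m}`. -/
def Dd (q : Fin n → ℝ) : Set (Fin n → ℝ) :=
  {v | ∃ m, (S.P q).mulVec m = m ∧ v = ((S.G q)⁻¹).mulVec m}

/-- Entrywise partial derivative `∂P/∂qⁱ` of the matrix-valued map `P`. -/
def dP (q : Fin n → ℝ) (i : Fin n) : Matrix (Fin n) (Fin n) ℝ :=
  fun j k => fderiv ℝ (fun q' => S.P q' j k) q (Pi.single i 1)

end MechSetting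

/-- The annihilator `D° = {α ∈ ℝⁿ : Σᵢ αᵢ vᵢ = 0 for all v ∈ D}` of a subspace `D ⊆ ℝⁿ`. -/
def annih {n : ℕ} (D : Submodule ℝ (Fin n → ℝ)) : Submodule ℝ (Fin n → ℝ) where
  carrier := {α | ∀ v ∈ D, ∑ i, α i * v i = 0}
  zero_mem' := by intro v hv; simp
  add_mem' := by
    intro a b ha hb v hv
    have h1 := ha v hv
    have h2 := hb v hv
    simp only [Pi.add_apply, add_mul, Finset.sum_add_distrib, h1, h2, add_zero]
  smul_mem' := by
    intro c a ha v hv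
    simp only [Pi.smul_apply, smul_eq_mul, mul_assoc, ← Finset.mul_sum, ha v hv, mul_zero]

section InverseEntries

attribute [local instance] Matrix.linftyOpNormedRing Matrix.linftyOpNormedAlgebra

theorem differentiable_inv_matrix_entry {n : ℕ} {E : Type*} [NormedAddCommGroup E]
    [NormedSpace ℝ E] {A : E → Matrix (Fin n) (Fin n) ℝ}
    (hA : ∀ i j, Differentiable ℝ fun x => A x i j) (hu : ∀ x, IsUnit (A x)) (i j : Fin n) :
    Differentiable ℝ fun x => (A x)⁻¹ i j := by
  intro x
  obtain ⟨u, hux⟩ := hu x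
  have hAx : DifferentiableAt ℝ A x :=
    differentiableAt_pi.2 fun a => differentiableAt_pi.2 fun b => hA a b x
  have hinv : DifferentiableAt ℝ (fun y => (A y)⁻¹) x := by
    simp only [Matrix.nonsing_inv_eq_ringInverse]
    refine DifferentiableAt.comp x (g := Ring.inverse) ?_ hAx
    rw [← hux]
    exact differentiableAt_inverse u.isUnit
  exact differentiableAt_pi.1 (differentiableAt_pi.1 hinv i) j

end InverseEntries

namespace MechSetting

variable {n : ℕ} (S : MechSetting n)

theorem differentiable_H : Differentiable ℝ S.H := by
  have hG := differentiable_inv_matrix_entry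
    (fun i j => (S.G_smooth i j).differentiable (by simp)) fun q => (S.G_posdef q).isUnit
  have hV := S.V_smooth.differentiable (by simp)
  have hG' : ∀ i j, Differentiable ℝ fun x : PS n => (S.G x.1)⁻¹ i j :=
    fun i j => (hG i j).comp differentiable_fst
  have hfst : ∀ i, Differentiable ℝ fun x : PS n => x.2.1 i :=
    fun i => by fun_prop
  refine Differentiable.add (Differentiable.const_mul ?_ _)
    (hV.comp (differentiable_fst.prodMk (differentiable_snd.comp differentiable_snd)))
  exact Differentiable.fun_sum fun i _ => Differentiable.fun_sum fun j _ =>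
    ((hfst i).mul (hG' i j)).mul (hfst j)

theorem H_eq_dotProduct (x : PS n) :
    S.H x = 1 / 2 * (x.2.1 ⬝ᵥ (S.G x.1)⁻¹ *ᵥ x.2.1) + S.V (x.1, x.2.2) := by
  simp only [H, dotProduct, Matrix.mulVec, Finset.mul_sum, mul_assoc]

theorem pdp_H (x : PS n) (i : Fin n) : pdp S.H x i = ((S.G x.1)⁻¹ *ᵥ x.2.1) i := by
  obtain ⟨q, p, z⟩ := x
  set A := (S.G q)⁻¹ with hA
  have hAT : Aᵀ = A := by rw [hA, Matrix.transpose_nonsing_inv, S.G_symm q]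
  have hquad : ∀ t : ℝ, S.H ((q, p, z) + t • (0, Pi.single i 1, 0)) =
      1 / 2 * (p ⬝ᵥ A *ᵥ p + t * (2 * (A *ᵥ p) i) + t ^ 2 * A i i) + S.V (q, z) := by
    intro t
    have hcross : p ⬝ᵥ A.col i = (A *ᵥ p) i := by
      rw [← Matrix.mulVec_single_one, Matrix.dotProduct_mulVec, dotProduct_single_one,
        ← Matrix.mulVec_transpose, hAT]
    rw [H_eq_dotProduct]
    simp only [Prod.smul_mk, Prod.mk_add_mk, smul_zero, add_zero, ← hA, Matrix.mulVec_add,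
      Matrix.mulVec_smul, add_dotProduct, dotProduct_add, smul_dotProduct, dotProduct_smul,
      hcross, single_one_dotProduct, Matrix.mulVec_single_one, Matrix.col_apply, smul_eq_mul]
    ring_nf
  have hline : HasLineDerivAt ℝ S.H ((A *ᵥ p) i) (q, p, z) (0, Pi.single i 1, 0) := by
    unfold HasLineDerivAt
    simp only [hquad]
    have h := (((((hasDerivAt_id (0 : ℝ)).mul_const (2 * (A *ᵥ p) i)).const_add
      (p ⬝ᵥ A *ᵥ p)).add (((hasDerivAt_id (0 : ℝ)).pow 2).mul_const (A i i))).const_mul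
        (1 / 2)).add_const (S.V (q, z))
    exact h.congr_deriv (by simp)
  rw [pdp, ← (S.differentiable_H _).lineDeriv_eq_fderiv, hline.lineDeriv]

end MechSetting

/-- integral curves of a solution `X` of the constrained contact equations
lying in `M×ℝ` satisfy the constrained Hamiltonian Herglotz equations. -/
theorem statement_9 {n k : ℕ} (S : MechSetting n)
    (Φ : Fin k → (Fin n → ℝ) → (Fin n → ℝ))
    (hΦ : ∀ a, ContDiff ℝ (⊤ : ℕ∞) (Φ a))
    (hann : ∀ a q, ∀ v ∈ S.Dd q, ∑ i, Φ a q i * v i = 0)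
    (X : PS n → PS n) (lam : Fin k → PS n → ℝ)
    (heq : ∀ x : PS n, S.onM x →
      flatMap x (X x) - dCov S.H x + (S.H x + pdz S.H x) • etaCov x
        = (fun i => ∑ a, lam a x * Φ a x.1 i, 0, 0))
    (ξ : ℝ → PS n) (hint : ∀ t, HasDerivAt ξ (X (ξ t)) t)
    (hM : ∀ t, S.onM (ξ t)) :
    ∀ t, (∀ i, deriv (fun s => (ξ s).1 i) t = pdp S.H (ξ t) i)
      ∧ (∀ i, deriv (fun s => (ξ s).2.1 i) t
            = -pdq S.H (ξ t) i - (ξ t).2.1 i * pdz S.H (ξ t)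
              - ∑ a, lam a (ξ t) * Φ a (ξ t).1 i)
      ∧ deriv (fun s => (ξ s).2.2) t
          = (∑ i, (ξ t).2.1 i * pdp S.H (ξ t) i) - S.H (ξ t)
      ∧ ∀ a, (∑ i, Φ a (ξ t).1 i * deriv (fun s => (ξ s).1 i) t) = 0 := by
  intro t
  have hflat := heq (ξ t) (hM t)
  have hq : ∀ i, (X (ξ t)).1 i = pdp S.H (ξ t) i := fun i => by
    have h := congrFun (congrArg (fun w : PS n => w.2.1) hflat) i
    simp only [flatMap, dCov, etaCov, Prod.snd_add, Prod.fst_add, Prod.snd_sub, Prod.fst_sub,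
      Prod.smul_mk, smul_zero, Pi.add_apply, Pi.sub_apply, Pi.zero_apply] at h
    linarith
  have hz : (X (ξ t)).2.2 - ∑ j, (ξ t).2.1 j * (X (ξ t)).1 j = -S.H (ξ t) := by
    have h := congrArg (fun w : PS n => w.2.2) hflat
    simp only [flatMap, dCov, etaCov, Prod.snd_add, Prod.snd_sub, Prod.smul_mk,
      smul_eq_mul] at h
    linarith
  have hp : ∀ i, (X (ξ t)).2.1 i = -pdq S.H (ξ t) i - (ξ t).2.1 i * pdz S.H (ξ t)
      - ∑ a, lam a (ξ t) * Φ a (ξ t).1 i := fun i => by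
    have h := congrFun (congrArg (fun w : PS n => w.1) hflat) i
    simp only [flatMap, dCov, etaCov, Prod.fst_add, Prod.fst_sub, Prod.smul_mk, Pi.add_apply,
      Pi.sub_apply, Pi.smul_apply, smul_eq_mul] at h
    rw [hz] at h
    linarith
  have hdq : ∀ i, deriv (fun s => (ξ s).1 i) t = pdp S.H (ξ t) i := fun i => by
    rw [(hasDerivAt_pi.1 (hint t).fst i).deriv, hq]
  refine ⟨hdq, fun i => ?_, ?_, fun a => ?_⟩
  · rw [(hasDerivAt_pi.1 (hint t).snd.fst i).deriv, hp]
  · rw [HasDerivAt.deriv (f' := (X (ξ t)).2.2) (by simpa using (HasFDerivAt.snd (HasFDerivAt.snd (hint t).hasFDerivAt)).hasDerivAt)]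
    simp only [hq] at hz
    linarith
  · simp only [hdq, S.pdp_H]
    exact hann a _ _ ⟨_, hM t, rfl⟩
end
end

section
/- Assume the mechanical setting. Then for every x = (q,p,z) ∈ M×ℝ, DΓ(x) · X_H(x) = DΓ(x) · X_{H∘Γ}(x), where DΓ(x) is the (Fréchet) derivative of Γ at x. (Hence the constrained Hamiltonian vector field X_{H,M} equals both Tγ(X_H|_{M×ℝ}) and Tγ(X_{H∘γ}|_{M×ℝ}).) -/
open scoped BigOperators Matrix
noncomputable section

theorem Differentiable.matrix_det {E : Type*} [NormedAddCommGroup E] [NormedSpace ℝ E] {m : ℕ}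
    {A : E → Matrix (Fin m) (Fin m) ℝ} (hA : ∀ i j, Differentiable ℝ fun x => A x i j) :
    Differentiable ℝ fun x => (A x).det := by
  simp only [Matrix.det_apply]
  fun_prop

theorem Differentiable.matrix_inv_apply {E : Type*} [NormedAddCommGroup E] [NormedSpace ℝ E]
    {m : ℕ} {A : E → Matrix (Fin m) (Fin m) ℝ} (hA : ∀ i j, Differentiable ℝ fun x => A x i j)
    (hdet : ∀ x, (A x).det ≠ 0) (i j : Fin m) : Differentiable ℝ fun x => (A x)⁻¹ i j := by
  simp only [Matrix.inv_def, Ring.inverse_eq_inv', Matrix.smul_apply, smul_eq_mul,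
    Matrix.adjugate_apply]
  refine ((Differentiable.matrix_det hA).inv hdet).mul (Differentiable.matrix_det fun k l => ?_)
  simp only [Matrix.updateRow_apply]
  split_ifs
  · fun_prop
  · exact hA k l

namespace MechSetting

variable {n : ℕ} (S : MechSetting n)

theorem differentiable_Gam : Differentiable ℝ S.Gam := by
  have hP := fun i j => (S.P_smooth i j).differentiable (by simp)
  unfold Gam
  refine differentiable_fst.prodMk (.prodMk (differentiable_pi.2 fun i => ?_) (by fun_prop))
  simp only [Matrix.mulVec, dotProduct]
  fun_prop

theorem Gam_comp_Gam : S.Gam ∘ S.Gam = S.Gam := by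
  funext x
  simp [Gam, Matrix.mulVec_mulVec, S.P_proj]

theorem H_eq (x : PS n) :
    S.H x = (1 / 2) * (x.2.1 ⬝ᵥ (S.G x.1)⁻¹ *ᵥ x.2.1) + S.V (x.1, x.2.2) := by
  simp only [H, dotProduct, Matrix.mulVec, Finset.mul_sum, mul_assoc]

theorem fderiv_Gam_fst (x v : PS n) : (fderiv ℝ S.Gam x v).1 = v.1 := by
  have h := (S.differentiable_Gam x).hasFDerivAt.fst.unique
    (hasFDerivAt_fst (𝕜 := ℝ) (p := x))
  exact DFunLike.congr_fun h v

theorem fderiv_Gam_snd_snd (x v : PS n) : (fderiv ℝ S.Gam x v).2.2 = v.2.2 := by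
  have h := (S.differentiable_Gam x).hasFDerivAt.snd.snd.unique
    ((hasFDerivAt_snd (𝕜 := ℝ) (p := x)).snd)
  exact DFunLike.congr_fun h v

theorem fderiv_Gam_momentum (x : PS n) (w : Fin n → ℝ) :
    fderiv ℝ S.Gam x (0, w, 0) = (0, S.P x.1 *ᵥ w, 0) := by
  rw [← (S.differentiable_Gam x).lineDeriv_eq_fderiv]
  refine HasLineDerivAt.lineDeriv ?_
  have h : (fun t : ℝ => S.Gam (x + t • (0, w, 0))) =
      fun t : ℝ => S.Gam x + t • ((0, S.P x.1 *ᵥ w, 0) : PS n) := by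
    funext t
    simp [Gam, Matrix.mulVec_add, Matrix.mulVec_smul]
  rw [HasLineDerivAt, h]
  simpa using ((hasDerivAt_id (0 : ℝ)).smul_const ((0, S.P x.1 *ᵥ w, 0) : PS n)).const_add
    (S.Gam x)

/-- On the constraint submanifold, `ker P` is `G⁻¹`-orthogonal to the momentum. -/
theorem onM.dotProduct_inv_mulVec_eq_zero {S : MechSetting n} {x : PS n} (hx : S.onM x)
    {w : Fin n → ℝ} (hw : S.P x.1 *ᵥ w = 0) : x.2.1 ⬝ᵥ (S.G x.1)⁻¹ *ᵥ w = 0 := by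
  rw [onM] at hx
  rw [← hx, ← Matrix.vecMul_transpose, ← Matrix.dotProduct_mulVec, Matrix.mulVec_mulVec, S.P_symm,
    ← Matrix.mulVec_mulVec, hw, Matrix.mulVec_zero, dotProduct_zero]

theorem onM.fderiv_H_momentum_eq_zero {S : MechSetting n} {x : PS n} (hx : S.onM x)
    {w : Fin n → ℝ} (hw : S.P x.1 *ᵥ w = 0) : fderiv ℝ S.H x (0, w, 0) = 0 := by
  rw [← (S.differentiable_H x).lineDeriv_eq_fderiv]
  refine HasLineDerivAt.lineDeriv ?_
  have h₁ := hx.dotProduct_inv_mulVec_eq_zero hw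
  have h₂ : w ⬝ᵥ (S.G x.1)⁻¹ *ᵥ x.2.1 = 0 := by
    rw [← h₁, Matrix.dotProduct_mulVec, ← Matrix.mulVec_transpose, Matrix.transpose_nonsing_inv,
      S.G_symm x.1, dotProduct_comm]
  have h : (fun t : ℝ => S.H (x + t • (0, w, 0))) =
      fun t : ℝ => S.H x + t ^ 2 * (1 / 2 * (w ⬝ᵥ (S.G x.1)⁻¹ *ᵥ w)) := by
    funext t
    simp [H_eq, Matrix.mulVec_add, Matrix.mulVec_smul, h₁, h₂]
    ring
  rw [HasLineDerivAt, h]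
  simpa using ((hasDerivAt_pow 2 (0 : ℝ)).mul_const
    (1 / 2 * (w ⬝ᵥ (S.G x.1)⁻¹ *ᵥ w))).const_add (S.H x)

theorem onM.Gam_eq {S : MechSetting n} {x : PS n} (hx : S.onM x) : S.Gam x = x := by
  rw [onM] at hx
  simp [Gam, hx]

/-- On the constraint submanifold, `Γ` moves tangent vectors only along `ker P`. -/
theorem onM.exists_fderiv_Gam {S : MechSetting n} {x : PS n} (hx : S.onM x) (v : PS n) :
    ∃ w, S.P x.1 *ᵥ w = 0 ∧ fderiv ℝ S.Gam x v = v + (0, w, 0) := by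
  have hv : fderiv ℝ S.Gam x v = v + (0, (fderiv ℝ S.Gam x v).2.1 - v.2.1, 0) := by
    refine Prod.ext ?_ (Prod.ext ?_ ?_)
    · simp [fderiv_Gam_fst]
    · simp
    · simp [fderiv_Gam_snd_snd]
  refine ⟨_, ?_, hv⟩
  have hidem : fderiv ℝ S.Gam x (fderiv ℝ S.Gam x v) = fderiv ℝ S.Gam x v := by
    have h := fderiv_comp x (S.differentiable_Gam (S.Gam x)) (S.differentiable_Gam x)
    rw [Gam_comp_Gam, hx.Gam_eq] at h
    exact (DFunLike.congr_fun h v).symm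
  have h := congrArg (fderiv ℝ S.Gam x) hv
  rw [hidem, map_add, left_eq_add, fderiv_Gam_momentum] at h
  exact congrArg (fun y : PS n => y.2.1) h

theorem onM.fderiv_H_comp_Gam {S : MechSetting n} {x : PS n} (hx : S.onM x) :
    fderiv ℝ (S.H ∘ S.Gam) x = fderiv ℝ S.H x := by
  rw [fderiv_comp x (S.differentiable_H _) (S.differentiable_Gam x), hx.Gam_eq]
  refine ContinuousLinearMap.ext fun v => ?_
  obtain ⟨w, hw, hv⟩ := hx.exists_fderiv_Gam v
  rw [ContinuousLinearMap.comp_apply, hv, map_add, hx.fderiv_H_momentum_eq_zero hw, add_zero]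

theorem onM.XH_comp_Gam {S : MechSetting n} {x : PS n} (hx : S.onM x) :
    XH (S.H ∘ S.Gam) x = XH S.H x := by
  simp only [XH, pdp, pdq, pdz, hx.fderiv_H_comp_Gam, Function.comp_apply, hx.Gam_eq]

end MechSetting

/-- on `M×ℝ`, `TΓ(X_H) = TΓ(X_{H∘Γ})`. -/
theorem statement_11 {n : ℕ} (S : MechSetting n) (x : PS n) (hx : S.onM x) :
    fderiv ℝ S.Gam x (XH S.H x) = fderiv ℝ S.Gam x (XH (S.H ∘ S.Gam) x) := by
  rw [hx.XH_comp_Gam]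
end
end
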